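/- Let A be a unital C*-algebra and let φ : A → A be a ℂ-linear map that is unital (φ(1) = 1) and positive (φ maps positive elements to positive elements). If T ∈ A satisfies Im T ≥ ε·1 for some ε > 0, then T and φ(T⁻¹) are invertible and (φ(T⁻¹))⁻¹ ∈ H₊(A), i.e. Im((φ(T⁻¹))⁻¹) ≥ δ·1 for some δ > 0. -/

import Mathlib

/-- The imaginary part `Im T := (T - T*)/(2i)` of an element of a C*-algebra. -/
noncomputable def cstarIm {A : Type*} [CStarAlgebra A] (T : A) : A :=
  ((2 * Complex.I)⁻¹ : ℂ) • (T - star T)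

lemma ringInverse_neg {R : Type*} [Ring R] {x : R} (hx : IsUnit x) :
    Ring.inverse (-x) = -Ring.inverse x := by
  obtain ⟨u, rfl⟩ := hx
  rw [← Units.val_neg, Ring.inverse_unit, Ring.inverse_unit, inv_neg, Units.val_neg]

section UpperHalfPlane

variable {A : Type*} [CStarAlgebra A]

lemma sub_star_eq_smul_cstarIm (T : A) : T - star T = (2 * Complex.I) • cstarIm T := by
  rw [cstarIm, smul_smul, mul_inv_cancel₀ (by simp), one_smul]

lemma cstarIm_neg (T : A) : cstarIm (-T) = -cstarIm T := by
  simp only [cstarIm, star_neg, ← smul_neg]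
  congr 1
  abel

lemma cstarIm_inverse {T : A} (hT : IsUnit T) :
    cstarIm (Ring.inverse T) = -(Ring.inverse T * cstarIm T * star (Ring.inverse T)) := by
  have h₁ : Ring.inverse T * T = 1 := Ring.inverse_mul_cancel T hT
  have h₂ : star T * star (Ring.inverse T) = 1 := by rw [← star_mul, h₁, star_one]
  simp only [cstarIm, mul_smul_comm, smul_mul_assoc, ← smul_neg]
  congr 1
  rw [mul_sub, sub_mul, h₁, one_mul, mul_assoc, h₂, mul_one, neg_sub]

variable [PartialOrder A] [StarOrderedRing A]

lemma isUnit_of_smul_one_le_cstarIm {T : A} {ε : ℝ} (hε : 0 < ε)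
    (h : ε • (1 : A) ≤ cstarIm T) : IsUnit T := by
  set R : ℝ := (‖T‖ ^ 2 + 1) / (2 * ε) + 1 with hR
  have hR1 : 1 ≤ R := by rw [hR]; linarith [show 0 ≤ (‖T‖ ^ 2 + 1) / (2 * ε) by positivity]
  have hRε : ‖T‖ ^ 2 + 1 ≤ 2 * R * ε := by
    have : 2 * R * ε = ‖T‖ ^ 2 + 1 + 2 * ε := by rw [hR]; field_simp
    linarith
  set z : ℂ := Complex.I * R with hz
  have hz0 : z ≠ 0 := by simp [hz]; linarith
  have hzn : ‖z‖ = R := by simp [hz]; linarith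
  set D : A := T - z • 1 with hD
  have hDD : star D * D = star T * T - (2 * R) • cstarIm T + (R ^ 2) • (1 : A) := by
    have hzc : star z = -z := by simp [hz]
    have hzz : z * z = -(R ^ 2 : ℝ) := by
      rw [hz, mul_mul_mul_comm, Complex.I_mul_I]; push_cast; ring
    have hIm : z • (T - star T) = -((2 * R) • cstarIm T) := by
      rw [sub_star_eq_smul_cstarIm, smul_smul, ← Complex.coe_smul, ← neg_smul]
      congr 1
      rw [hz, show Complex.I * (R : ℂ) * (2 * Complex.I) = 2 * R * (Complex.I * Complex.I) by ring,
        Complex.I_mul_I]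
      push_cast; ring
    have hsq : (R ^ 2) • (1 : A) = -((z * z) • (1 : A)) := by
      rw [hzz, neg_smul, neg_neg, Complex.coe_smul]
    rw [sub_eq_add_neg (star T * T), ← hIm, hsq, hD, star_sub, star_smul, star_one, hzc]
    simp only [sub_mul, mul_sub, smul_sub, neg_smul, mul_smul_comm, smul_mul_assoc, mul_one,
      one_mul, smul_smul, neg_mul, smul_neg]
    abel
  have hle : star D * D ≤ algebraMap ℝ A (R ^ 2 - 1) := by
    have h₁ : star T * T ≤ (‖T‖ ^ 2) • (1 : A) := by
      simpa [Algebra.algebraMap_eq_smul_one] using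
        CStarAlgebra.star_mul_le_algebraMap_norm_sq (a := T)
    have h₂ : (2 * R * ε) • (1 : A) ≤ (2 * R) • cstarIm T := by
      rw [mul_smul]
      exact smul_le_smul_of_nonneg_left h (by linarith)
    have h₃ : (‖T‖ ^ 2 + 1) • (1 : A) ≤ (2 * R * ε) • (1 : A) :=
      smul_le_smul_of_nonneg_right hRε zero_le_one
    rw [hDD, Algebra.algebraMap_eq_smul_one]
    calc star T * T - (2 * R) • cstarIm T + (R ^ 2) • (1 : A)
        ≤ (‖T‖ ^ 2) • (1 : A) - (‖T‖ ^ 2 + 1) • (1 : A) + (R ^ 2) • (1 : A) := by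
          gcongr
          exact h₃.trans h₂
      _ = (R ^ 2 - 1) • (1 : A) := by module
  have hnorm : ‖D‖ < R := by
    have := (CStarAlgebra.norm_le_iff_le_algebraMap (star D * D)
      (show 0 ≤ R ^ 2 - 1 by nlinarith) (star_mul_self_nonneg D)).2 hle
    rw [CStarRing.norm_star_mul_self] at this
    nlinarith [norm_nonneg D]
  have hlt : ‖-(z⁻¹ • D)‖ < 1 := by
    rw [norm_neg, norm_smul, norm_inv, hzn, inv_mul_lt_one₀ (by linarith)]
    exact hnorm
  have hT : T = (Units.mk0 z hz0) • (1 - -(z⁻¹ • D)) := by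
    rw [Units.smul_mk0, sub_neg_eq_add, smul_add, smul_smul, mul_inv_cancel₀ hz0, one_smul, hD]
    abel
  rw [hT]
  exact (isUnit_one_sub_of_norm_lt_one hlt).smul _

lemma exists_smul_one_le_cstarIm_neg_inverse {T : A} {ε : ℝ} (hε : 0 < ε)
    (h : ε • (1 : A) ≤ cstarIm T) :
    ∃ δ : ℝ, 0 < δ ∧ δ • (1 : A) ≤ cstarIm (-Ring.inverse T) := by
  have hT := isUnit_of_smul_one_le_cstarIm hε h
  set S := Ring.inverse T with hS
  have hST : S * T = 1 := Ring.inverse_mul_cancel T hT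
  have hST' : star T * star S = 1 := by rw [← star_mul, hST, star_one]
  have hc : 0 < ‖T‖ ^ 2 + 1 := by positivity
  have hone : (1 : A) ≤ (‖T‖ ^ 2 + 1) • (S * star S) := by
    have h₁ : T * star T ≤ (‖T‖ ^ 2 + 1) • (1 : A) := by
      refine (CStarAlgebra.mul_star_le_algebraMap_norm_sq (a := T)).trans ?_
      rw [Algebra.algebraMap_eq_smul_one]
      exact smul_le_smul_of_nonneg_right (by linarith) zero_le_one
    have h₂ := star_right_conjugate_le_conjugate h₁ S
    rwa [← mul_assoc S, hST, one_mul, hST', mul_smul_comm, mul_one, smul_mul_assoc] at h₂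
  refine ⟨ε * (‖T‖ ^ 2 + 1)⁻¹, by positivity, ?_⟩
  rw [cstarIm_neg, cstarIm_inverse hT, neg_neg, mul_smul]
  calc ε • (‖T‖ ^ 2 + 1)⁻¹ • (1 : A)
      ≤ ε • (‖T‖ ^ 2 + 1)⁻¹ • (‖T‖ ^ 2 + 1) • (S * star S) :=
        smul_le_smul_of_nonneg_left
          (smul_le_smul_of_nonneg_left hone (by positivity)) hε.le
    _ = S * (ε • 1) * star S := by
        rw [inv_smul_smul₀ hc.ne', mul_smul_comm, mul_one, smul_mul_assoc]
    _ ≤ S * cstarIm T * star S := star_right_conjugate_le_conjugate h S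

lemma smul_one_le_cstarIm_map (φ : A →ₗ[ℂ] A) (hunital : φ 1 = 1)
    (hpos : ∀ a : A, 0 ≤ a → 0 ≤ φ a) {T : A} {ε : ℝ} (h : ε • (1 : A) ≤ cstarIm T) :
    ε • (1 : A) ≤ cstarIm (φ T) := by
  have hstar : φ (star T) = star (φ T) := map_star (PositiveLinearMap.mk₀ φ hpos) T
  have hmap : φ (cstarIm T) = cstarIm (φ T) := by
    rw [cstarIm, map_smul, map_sub, hstar, cstarIm]
  have h₁ := hpos _ (sub_nonneg.2 h)
  rwa [map_sub, hmap, ← Complex.coe_smul, map_smul, hunital, Complex.coe_smul,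
    sub_nonneg] at h₁

end UpperHalfPlane

/-- Mechanism behind Propositions 3.2 and 3.3 of the paper: if `φ` is a unital
positive linear map on a unital C*-algebra and `Im T ≥ ε • 1` for some `ε > 0`,
then `T` and `φ(T⁻¹)` are invertible and `(φ(T⁻¹))⁻¹` lies in the upper
half-plane, i.e. `Im ((φ(T⁻¹))⁻¹) ≥ δ • 1` for some `δ > 0`. -/
theorem inv_map_inv_mem_upperHalfPlane_of_unital_positive
    {A : Type*} [CStarAlgebra A] [PartialOrder A] [StarOrderedRing A] [Nontrivial A]
    (φ : A →ₗ[ℂ] A) (hunital : φ 1 = 1) (hpos : ∀ a : A, 0 ≤ a → 0 ≤ φ a)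
    (T : A) (ε : ℝ) (hε : 0 < ε) (h : ε • (1 : A) ≤ cstarIm T) :
    IsUnit T ∧ IsUnit (φ (Ring.inverse T)) ∧
      ∃ δ : ℝ, 0 < δ ∧
        δ • (1 : A) ≤ cstarIm (Ring.inverse (φ (Ring.inverse T))) := by
  have hT := isUnit_of_smul_one_le_cstarIm hε h
  obtain ⟨η, hη, hS⟩ := exists_smul_one_le_cstarIm_neg_inverse hε h
  have hφ := smul_one_le_cstarIm_map φ hunital hpos hS
  have hunit := isUnit_of_smul_one_le_cstarIm hη hφ
  obtain ⟨δ, hδ, hδ'⟩ := exists_smul_one_le_cstarIm_neg_inverse hη hφ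
  rw [map_neg] at hunit hδ'
  refine ⟨hT, (IsUnit.neg_iff _).1 hunit, δ, hδ, ?_⟩
  rwa [ringInverse_neg ((IsUnit.neg_iff _).1 hunit), neg_neg] at hδ'
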